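/- (Bóna) Let L = lim_{n→∞} (s_n(1324))^{1/n} be the Stanley–Wilf growth constant of the pattern 1324 (this limit exists by the Marcus–Tardos theorem). Then the Stanley–Wilf growth constant of the pattern 53421 satisfies lim_{n→∞} (s_n(53421))^{1/n} = (1 + √L)^2. -/

import Mathlib

open Filter

/-- `π` contains the pattern `τ`: some subsequence of `π` of length `k` has its
entries in the same relative order as `τ`. -/
def PattContains {k n : ℕ} (τ : Equiv.Perm (Fin k)) (π : Equiv.Perm (Fin n)) : Prop :=
  ∃ f : Fin k → Fin n, StrictMono f ∧ ∀ a b : Fin k, π (f a) < π (f b) ↔ τ a < τ b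

/-- `avoidCount τ n` is the number of permutations of `{1, …, n}` avoiding the
pattern `τ`. -/
noncomputable def avoidCount {k : ℕ} (τ : Equiv.Perm (Fin k)) (n : ℕ) : ℕ :=
  Nat.card {π : Equiv.Perm (Fin n) // ¬ PattContains τ π}

/-- The pattern `1324`, i.e. the permutation of `{1,…,4}` sending
`1↦1, 2↦3, 3↦2, 4↦4` (written here 0-indexed on `Fin 4`). -/
noncomputable def patt1324 : Equiv.Perm (Fin 4) :=
  Equiv.ofBijective ![0, 2, 1, 3] (by decide)

/-- The pattern `53421`, i.e. the permutation of `{1,…,5}` sending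
`1↦5, 2↦3, 3↦4, 4↦2, 5↦1` (written here 0-indexed on `Fin 5`). -/
noncomputable def patt53421 : Equiv.Perm (Fin 5) :=
  Equiv.ofBijective ![4, 2, 3, 1, 0] (by decide)


section Containment

variable {α β : Type*} [LinearOrder α] [LinearOrder β]

/-- Four entries of `f` form the pattern `1324`. -/
def Is1324 (f : α → β) (b c d e : α) : Prop :=
  b < c ∧ c < d ∧ d < e ∧ f b < f d ∧ f d < f c ∧ f c < f e

/-- `f` contains the pattern `1324`. -/
def Has1324 (f : α → β) : Prop :=
  ∃ b c d e, Is1324 f b c d e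

/-- `f` contains the pattern `12435`. -/
def Has12435 (f : α → β) : Prop :=
  ∃ a b c d e, a < b ∧ f a < f b ∧ Is1324 f b c d e

end Containment

theorem pattContains_patt1324_iff {n : ℕ} (π : Equiv.Perm (Fin n)) :
    PattContains patt1324 π ↔ Has1324 π := by
  constructor
  · rintro ⟨f, hf, h⟩
    refine ⟨f 0, f 1, f 2, f 3, hf (by decide), hf (by decide), hf (by decide), ?_, ?_, ?_⟩ <;>
      exact (h _ _).2 (by simp [patt1324])
  · rintro ⟨b, c, d, e, h1, h2, h3, h4, h5, h6⟩
    refine ⟨![b, c, d, e], ?_, ?_⟩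
    · rw [Fin.strictMono_iff_lt_succ]
      intro i
      fin_cases i <;> simpa
    · intro i j
      fin_cases i <;> fin_cases j <;> simp [patt1324] <;> order

theorem pattContains_patt53421_iff {n : ℕ} (π : Equiv.Perm (Fin n)) :
    PattContains patt53421 π ↔ Has12435 (π ∘ Fin.rev) := by
  constructor
  · rintro ⟨f, hf, h⟩
    refine ⟨(f 4).rev, (f 3).rev, (f 2).rev, (f 1).rev, (f 0).rev, ?_, ?_, ?_, ?_, ?_, ?_, ?_, ?_⟩
    all_goals simp only [Fin.rev_lt_rev, Function.comp_apply, Fin.rev_rev]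
    all_goals first | exact hf (by decide) | exact (h _ _).2 (by simp [patt53421])
  · rintro ⟨a, b, c, d, e, h1, h2, h3, h4, h5, h6, h7, h8⟩
    refine ⟨![e.rev, d.rev, c.rev, b.rev, a.rev], ?_, ?_⟩
    · rw [Fin.strictMono_iff_lt_succ]
      intro i
      fin_cases i <;> simpa
    · simp only [Function.comp_apply] at *
      intro i j
      fin_cases i <;> fin_cases j <;> simp [patt53421] <;> order

section Extension

variable {α γ : Type*} {M k : ℕ}

/-- A subset of `Fin (M + k)` with `k` elements. -/
abbrev Choice (M k : ℕ) := {U : Finset (Fin (M + k)) // U.card = k}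

theorem Choice.card_compl (U : Choice M k) : (U.1ᶜ).card = M := by
  rw [Finset.card_compl, U.2, Fintype.card_fin, Nat.add_sub_cancel]

/-- The order-preserving splitting of `Fin (M + k)` along a subset. -/
def Choice.split (U : Choice M k) : Fin k ⊕ Fin M ≃ Fin (M + k) :=
  finSumEquivOfFinset U.2 U.card_compl

theorem Choice.split_inl_lt (U : Choice M k) {i j : Fin k} :
    U.split (.inl i) < U.split (.inl j) ↔ i < j := by
  simp [Choice.split]

theorem Choice.split_inr_lt (U : Choice M k) {i j : Fin M} :
    U.split (.inr i) < U.split (.inr j) ↔ i < j := by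
  simp [Choice.split]

theorem Choice.mem_iff (U : Choice M k) (x : Fin (M + k)) :
    x ∈ U.1 ↔ ∃ i, U.split (.inl i) = x := by
  have := Finset.range_orderEmbOfFin U.1 U.2
  simp only [Choice.split, finSumEquivOfFinset_inl]
  rw [← Finset.mem_coe, ← this, Set.mem_range]

/-- Values of the old entries after `k` new values have been interleaved with the top `M` ones. -/
def liftValue (V : Choice M k) : γ ⊕ₗ Fin M → γ ⊕ₗ Fin (M + k) := fun x =>
  match ofLex x with
  | .inl g => Sum.inlₗ g
  | .inr j => Sum.inrₗ (V.split (.inr j))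

theorem liftValue_lt_iff [LinearOrder γ] (V : Choice M k) {x y : γ ⊕ₗ Fin M} :
    liftValue V x < liftValue V y ↔ x < y := by
  induction x using Lex.rec with | _ x
  induction y using Lex.rec with | _ y
  rcases x with x | x <;> rcases y with y | y <;>
    simp [liftValue, Choice.split_inr_lt]

/-- Prepend `M` new largest values arranged as `σ`, together with `k` decreasing entries whose
values are interleaved with the old top `M` values. -/
def extend (U V : Choice M k) (σ : Fin M → Fin M) (ρ : α → γ ⊕ₗ Fin M) :
    Fin (M + k) ⊕ₗ α → (γ ⊕ₗ Fin (M + k)) ⊕ₗ Fin M := fun x =>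
  match ofLex x with
  | .inl i => match U.split.symm i with
    | .inl i => Sum.inlₗ (Sum.inrₗ (V.split (.inl i.rev)))
    | .inr j => Sum.inrₗ (σ j)
  | .inr a => Sum.inlₗ (liftValue V (ρ a))

variable (U V : Choice M k) (σ : Fin M → Fin M) (ρ : α → γ ⊕ₗ Fin M)

theorem extend_dec (i : Fin k) : extend U V σ ρ (Sum.inlₗ (U.split (.inl i))) =
    Sum.inlₗ (Sum.inrₗ (V.split (.inl i.rev))) := by
  simp [extend]

theorem extend_top (j : Fin M) : extend U V σ ρ (Sum.inlₗ (U.split (.inr j))) =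
    Sum.inrₗ (σ j) := by
  simp [extend]

theorem extend_old (a : α) : extend U V σ ρ (Sum.inrₗ a) = Sum.inlₗ (liftValue V (ρ a)) := by
  simp [extend]

theorem position_cases (x : Fin (M + k) ⊕ₗ α) : (∃ i, x = Sum.inlₗ (U.split (.inl i))) ∨
    (∃ i, x = Sum.inlₗ (U.split (.inr i))) ∨ ∃ a, x = Sum.inrₗ a := by
  induction x using Lex.rec with | _ x
  rcases x with x | x
  · obtain ⟨y | y, rfl⟩ := U.split.surjective x
    exacts [.inl ⟨y, rfl⟩, .inr (.inl ⟨y, rfl⟩)]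
  · exact .inr (.inr ⟨x, rfl⟩)

theorem liftValue_ne_dec (x : γ ⊕ₗ Fin M) (i : Fin k) :
    liftValue V x ≠ Sum.inrₗ (V.split (.inl i)) := by
  induction x using Lex.rec with | _ x
  rcases x with x | x <;> simp [liftValue]

theorem liftValue_injective : (liftValue V : γ ⊕ₗ Fin M → _).Injective := by
  intro x y
  induction x using Lex.rec with | _ x
  induction y using Lex.rec with | _ y
  rcases x with x | x <;> rcases y with y | y <;> simp [liftValue]

variable {σ ρ}

theorem extend_injective (hσ : σ.Injective) (hρ : ρ.Injective) :
    (extend U V σ ρ).Injective := by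
  intro x y
  rcases position_cases U x with ⟨i, rfl⟩ | ⟨i, rfl⟩ | ⟨i, rfl⟩ <;>
  rcases position_cases U y with ⟨j, rfl⟩ | ⟨j, rfl⟩ | ⟨j, rfl⟩ <;>
    simp [extend_dec, extend_top, extend_old, hσ.eq_iff, (liftValue_injective V).eq_iff,
      hρ.eq_iff, liftValue_ne_dec, (liftValue_ne_dec _ _ _).symm]

theorem extend_params_injective {U' V' : Choice M k} {σ' : Fin M → Fin M} {ρ' : α → γ ⊕ₗ Fin M}
    (h : extend U V σ ρ = extend U' V' σ' ρ') : U = U' ∧ V = V' ∧ σ = σ' ∧ ρ = ρ' := by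
  have hU : U = U' := by
    refine Subtype.ext (Finset.eq_of_subset_of_card_le ?_ (by rw [U.2, U'.2]))
    intro x hx
    obtain ⟨i, rfl⟩ := (U.mem_iff x).1 hx
    rw [U'.mem_iff]
    have := congrFun h (Sum.inlₗ (U.split (.inl i)))
    obtain ⟨y | y, hy⟩ := U'.split.surjective (U.split (.inl i))
    · exact ⟨y, hy⟩
    · rw [extend_dec, ← hy, extend_top] at this
      simp at this
  subst hU
  have hV : V = V' := by
    refine Subtype.ext (Finset.eq_of_subset_of_card_le ?_ (by rw [V.2, V'.2]))
    intro x hx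
    obtain ⟨i, rfl⟩ := (V.mem_iff x).1 hx
    rw [V'.mem_iff]
    have := congrFun h (Sum.inlₗ (U.split (.inl i.rev)))
    simp only [extend_dec, Fin.rev_rev] at this
    exact ⟨i, by simpa using this.symm⟩
  subst hV
  refine ⟨rfl, rfl, ?_, ?_⟩
  · funext j
    simpa [extend_top] using congrFun h (Sum.inlₗ (U.split (.inr j)))
  · funext a
    have := congrFun h (Sum.inrₗ a)
    simp only [extend_old] at this
    exact liftValue_injective V (by simpa using this)

variable [LinearOrder γ]

theorem exists_eq_top_of_lt {x : Fin (M + k) ⊕ₗ α} {j : Fin M}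
    (h : Sum.inrₗ j < extend U V σ ρ x) : ∃ i, x = Sum.inlₗ (U.split (.inr i)) := by
  rcases position_cases U x with ⟨i, rfl⟩ | ⟨i, rfl⟩ | ⟨i, rfl⟩ <;>
    simp [extend_dec, extend_top, extend_old] at h ⊢

variable [LinearOrder α]

/-- `f` contains the pattern `1324` within its entries with values in `Fin M`. -/
def TopHas1324 (f : α → γ ⊕ₗ Fin M) : Prop :=
  ∃ b c d e, Is1324 f b c d e ∧ ∃ j, f b = Sum.inrₗ j

theorem has1324_of_extend {j : Fin M} {c d e : Fin (M + k) ⊕ₗ α}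
    (h : Is1324 (extend U V σ ρ) (Sum.inlₗ (U.split (.inr j))) c d e) : Has1324 σ := by
  obtain ⟨h1, h2, h3, h4, h5, h6⟩ := h
  rw [extend_top] at h4
  obtain ⟨d, rfl⟩ := exists_eq_top_of_lt U V h4
  obtain ⟨c, rfl⟩ := exists_eq_top_of_lt U V (h4.trans h5)
  obtain ⟨e, rfl⟩ := exists_eq_top_of_lt U V ((h4.trans h5).trans h6)
  simp only [extend_top, Sum.Lex.inl_lt_inl_iff, Sum.Lex.inr_lt_inr_iff, Choice.split_inr_lt] at *
  exact ⟨j, c, d, e, h1, h2, h3, h4, h5, h6⟩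

theorem not_topHas1324_extend (hσ : ¬ Has1324 σ) : ¬ TopHas1324 (extend U V σ ρ) := by
  rintro ⟨b, c, d, e, h, j, hj⟩
  rcases position_cases U b with ⟨i, rfl⟩ | ⟨i, rfl⟩ | ⟨i, rfl⟩
  · simp [extend_dec] at hj
  · exact hσ (has1324_of_extend U V h)
  · simp [extend_old] at hj

theorem exists_eq_old_of_lt (U : Choice M k) {x : Fin (M + k) ⊕ₗ α} {a : α}
    (h : Sum.inrₗ a < x) : ∃ b, x = Sum.inrₗ b := by
  rcases position_cases U x with ⟨i, rfl⟩ | ⟨i, rfl⟩ | ⟨i, rfl⟩ <;>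
    simp at h ⊢

theorem not_has12435_extend (hσ : ¬ Has1324 σ) (hρ : ¬ Has12435 ρ) (hρ' : ¬ TopHas1324 ρ) :
    ¬ Has12435 (extend U V σ ρ) := by
  rintro ⟨a, b, c, d, e, hab, hab', h⟩
  rcases position_cases U b with ⟨b, rfl⟩ | ⟨b, rfl⟩ | ⟨b, rfl⟩
  · rcases position_cases U a with ⟨a, rfl⟩ | ⟨a, rfl⟩ | ⟨a, rfl⟩
    · simp only [extend_dec, Sum.Lex.inl_lt_inl_iff, Sum.Lex.inr_lt_inr_iff, Choice.split_inl_lt,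
        Fin.rev_lt_rev] at hab hab'
      exact hab.asymm hab'
    · simp [extend_dec, extend_top] at hab'
    · simp at hab
  · exact hσ (has1324_of_extend U V h)
  · obtain ⟨h1, h2, h3, h4, h5, h6⟩ := h
    obtain ⟨c, rfl⟩ := exists_eq_old_of_lt U h1
    obtain ⟨d, rfl⟩ := exists_eq_old_of_lt U h2
    obtain ⟨e, rfl⟩ := exists_eq_old_of_lt U h3
    simp only [extend_old, Sum.Lex.inl_lt_inl_iff, Sum.Lex.inr_lt_inr_iff,
      liftValue_lt_iff] at h1 h2 h3 h4 h5 h6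
    rcases position_cases U a with ⟨a, rfl⟩ | ⟨a, rfl⟩ | ⟨a, rfl⟩
    · refine hρ' ⟨b, c, d, e, ⟨h1, h2, h3, h4, h5, h6⟩, ?_⟩
      rw [extend_dec, extend_old, Sum.Lex.inl_lt_inl_iff] at hab'
      revert hab'
      generalize ρ b = y
      induction y using Lex.rec with | _ y
      rcases y with y | y <;> simp [liftValue]
    · simp [extend_top, extend_old] at hab'
    · simp only [extend_old, Sum.Lex.inl_lt_inl_iff, Sum.Lex.inr_lt_inr_iff,
        liftValue_lt_iff] at hab hab'
      exact hρ ⟨a, b, c, d, e, hab, hab', h1, h2, h3, h4, h5, h6⟩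

end Extension

section Counting

theorem avoidCount_patt1324 (n : ℕ) : avoidCount patt1324 n =
    Nat.card {σ : Fin n → Fin n // σ.Injective ∧ ¬ Has1324 σ} := by
  refine Nat.card_congr (Equiv.ofBijective
    (fun π => ⟨π.1, π.1.injective, fun h => π.2 ((pattContains_patt1324_iff _).2 h)⟩) ⟨?_, ?_⟩)
  · intro π π' h
    exact Subtype.ext (DFunLike.coe_injective (congrArg Subtype.val h))
  · intro ⟨σ, hσ, h⟩
    exact ⟨⟨Equiv.ofBijective σ hσ.bijective_of_finite,
      fun h' => h ((pattContains_patt1324_iff _).1 h')⟩, rfl⟩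

theorem avoidCount_patt53421 (n : ℕ) : avoidCount patt53421 n =
    Nat.card {f : Fin n → Fin n // f.Injective ∧ ¬ Has12435 f} := by
  refine Nat.card_congr (Equiv.ofBijective (fun π => ⟨π.1 ∘ Fin.rev,
    π.1.injective.comp Fin.rev_injective, fun h => π.2 ((pattContains_patt53421_iff _).2 h)⟩)
    ⟨?_, ?_⟩)
  · intro π π' h
    refine Subtype.ext (DFunLike.coe_injective ?_)
    exact Fin.rev_surjective.injective_comp_right (congrArg Subtype.val h)
  · intro ⟨f, hf, h⟩
    have e : (f ∘ Fin.rev) ∘ Fin.rev = f := by ext; simp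
    refine ⟨⟨Equiv.ofBijective (f ∘ Fin.rev) (hf.comp Fin.rev_injective).bijective_of_finite,
      fun h' => h ?_⟩, Subtype.ext e⟩
    have := (pattContains_patt53421_iff _).1 h'
    rwa [Equiv.coe_ofBijective, e] at this

theorem card_choice (M k : ℕ) : Nat.card (Choice M k) = (M + k).choose k := by
  simp

instance {α β : Type*} [Finite α] [Finite β] : Finite (α ⊕ₗ β) :=
  inferInstanceAs (Finite (α ⊕ β))

/-- The injective maps avoiding `12435` whose entries with values in `Fin M` avoid `1324`. -/
abbrev Good (α γ : Type*) [LinearOrder α] [LinearOrder γ] (M : ℕ) :=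
  {f : α → γ ⊕ₗ Fin M // f.Injective ∧ ¬ Has12435 f ∧ ¬ TopHas1324 f}

theorem card_good_step (α γ : Type*) [LinearOrder α] [LinearOrder γ] [Finite α] [Finite γ]
    (M k : ℕ) : avoidCount patt1324 M * (M + k).choose k ^ 2 * Nat.card (Good α γ M) ≤
      Nat.card (Good (Fin (M + k) ⊕ₗ α) (γ ⊕ₗ Fin (M + k)) M) := by
  have : avoidCount patt1324 M * (M + k).choose k ^ 2 * Nat.card (Good α γ M) =
      Nat.card ({σ : Fin M → Fin M // σ.Injective ∧ ¬ Has1324 σ} × (Choice M k × Choice M k) ×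
        Good α γ M) := by
    rw [Nat.card_prod, Nat.card_prod, Nat.card_prod, card_choice, avoidCount_patt1324, sq,
      mul_assoc]
  rw [this]
  refine Nat.card_le_card_of_injective (fun p => ⟨extend p.2.1.1 p.2.1.2 p.1.1 p.2.2.1,
    extend_injective _ _ p.1.2.1 p.2.2.2.1,
    not_has12435_extend _ _ p.1.2.2 p.2.2.2.2.1 p.2.2.2.2.2,
    not_topHas1324_extend _ _ p.1.2.2⟩) ?_
  rintro ⟨⟨σ, _⟩, ⟨U, V⟩, ⟨ρ, _⟩⟩ ⟨⟨σ', _⟩, ⟨U', V'⟩, ⟨ρ', _⟩⟩ h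
  obtain ⟨rfl, rfl, rfl, rfl⟩ := extend_params_injective _ _ (congrArg Subtype.val h)
  rfl

theorem natCard_sumLex (α β : Type*) [Finite α] [Finite β] :
    Nat.card (α ⊕ₗ β) = Nat.card α + Nat.card β :=
  (Nat.card_congr ofLex).trans Nat.card_sum

theorem card_good_le (α γ : Type*) [LinearOrder α] [LinearOrder γ] [Finite α] [Finite γ]
    {M n : ℕ} (hα : Nat.card α = n) (hγ : Nat.card γ + M = n) :
    Nat.card (Good α γ M) ≤ avoidCount patt53421 n := by
  have := Fintype.ofFinite α
  have := Fintype.ofFinite (γ ⊕ₗ Fin M)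
  have e : Fin n ≃o α := Fintype.orderIsoFinOfCardEq α (by rw [← Nat.card_eq_fintype_card, hα])
  have e' : Fin n ≃o γ ⊕ₗ Fin M := Fintype.orderIsoFinOfCardEq _ (by
    rw [← Nat.card_eq_fintype_card, natCard_sumLex, Nat.card_fin, hγ])
  rw [avoidCount_patt53421]
  refine Nat.card_le_card_of_injective (fun f => ⟨e'.symm ∘ f.1 ∘ e,
    e'.symm.injective.comp (f.2.1.comp e.injective), ?_⟩) ?_
  · rintro ⟨b, c, d, x, y, h⟩
    refine f.2.2.1 ⟨e b, e c, e d, e x, e y, ?_⟩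
    simpa [Is1324] using h
  · intro f g h
    have h1 := e'.symm.injective.comp_left (congrArg Subtype.val h)
    exact Subtype.ext (e.surjective.injective_comp_right h1)

theorem good_nonempty (r M : ℕ) : Nonempty (Good (Fin (r + M)) (Fin r) M) := by
  have e : Fin (r + M) ≃o Fin r ⊕ₗ Fin M := Fintype.orderIsoFinOfCardEq _ (by
    rw [← Nat.card_eq_fintype_card, natCard_sumLex, Nat.card_fin, Nat.card_fin])
  have h {b c d x} (h : Is1324 (e ∘ Fin.rev) b c d x) : False := by
    obtain ⟨h1, h2, h3, h4, h5, h6⟩ := h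
    simp only [Function.comp_apply, e.lt_iff_lt, Fin.rev_lt_rev] at h6
    exact (h2.trans h3).asymm h6
  refine ⟨⟨e ∘ Fin.rev, e.injective.comp Fin.rev_injective, ?_, ?_⟩⟩
  · rintro ⟨a, b, c, d, x, -, -, h'⟩
    exact h h'
  · rintro ⟨b, c, d, x, h', -⟩
    exact h h'

theorem exists_good (r M k m : ℕ) : ∃ (α γ : Type) (_ : LinearOrder α) (_ : LinearOrder γ),
    Finite α ∧ Finite γ ∧ Nat.card α = r + M + m * (M + k) ∧ Nat.card γ + M = Nat.card α ∧
      (avoidCount patt1324 M * (M + k).choose k ^ 2) ^ m ≤ Nat.card (Good α γ M) := by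
  induction m with
  | zero =>
    refine ⟨Fin (r + M), Fin r, inferInstance, inferInstance, inferInstance, inferInstance,
      by simp, by simp, ?_⟩
    have := good_nonempty r M
    rw [pow_zero]
    exact Nat.card_pos
  | succ m ih =>
    obtain ⟨α, γ, _, _, _, _, h1, h2, h3⟩ := ih
    refine ⟨Fin (M + k) ⊕ₗ α, γ ⊕ₗ Fin (M + k), inferInstance, inferInstance, inferInstance, inferInstance,
      ?_, ?_,
      le_trans ?_ (card_good_step α γ M k)⟩
    · rw [natCard_sumLex, Nat.card_fin, h1]
      ring
    · rw [natCard_sumLex, natCard_sumLex, Nat.card_fin, ← h2]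
      ring
    · rw [pow_succ, mul_comm]
      gcongr

theorem pow_le_avoidCount_patt53421 (r M k m : ℕ) :
    (avoidCount patt1324 M * (M + k).choose k ^ 2) ^ m ≤
      avoidCount patt53421 (r + M + m * (M + k)) := by
  obtain ⟨α, γ, _, _, _, _, h1, h2, h3⟩ := exists_good r M k m
  exact h3.trans (card_good_le α γ h1 (h2.trans h1))

/-- The positions of the left-to-right minima of `f`. -/
def leftToRightMin {n : ℕ} (f : Fin n → Fin n) : Finset (Fin n) :=
  {x | ∀ y < x, f x < f y}

/-- The map placing a decreasing sequence in the positions `U` and values `V` and the pattern `σ`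
elsewhere. -/
def merge {M k : ℕ} (U V : Choice M k) (σ : Fin M → Fin M) : Fin (M + k) → Fin (M + k) := fun x =>
  match U.split.symm x with
  | .inl i => V.split (.inl i.rev)
  | .inr j => V.split (.inr (σ j))

theorem exists_merge_eq {M k : ℕ} {f : Fin (M + k) → Fin (M + k)} (hf : f.Injective)
    (h : ¬ Has12435 f) (hk : (leftToRightMin f).card = k) :
    ∃ (U V : Choice M k) (σ : Fin M → Fin M), (σ.Injective ∧ ¬ Has1324 σ) ∧ merge U V σ = f := by
  let U : Choice M k := ⟨leftToRightMin f, hk⟩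
  let V : Choice M k := ⟨(leftToRightMin f).image f, by rw [Finset.card_image_of_injective _ hf, hk]⟩
  have hU (i : Fin k) : U.split (.inl i) ∈ leftToRightMin f := (U.mem_iff _).2 ⟨i, rfl⟩
  have hU' (j : Fin M) : U.split (.inr j) ∉ leftToRightMin f := by
    intro hj
    obtain ⟨i, hi⟩ := (U.mem_iff _).1 hj
    simp at hi
  have hσ (j : Fin M) : ∃ l, V.split (.inr l) = f (U.split (.inr j)) := by
    obtain ⟨y | y, hy⟩ := V.split.surjective (f (U.split (.inr j)))
    · have := (V.mem_iff _).2 ⟨y, hy⟩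
      exact absurd (hf.mem_finset_image.1 this) (hU' j)
    · exact ⟨y, hy⟩
  choose σ hσ using hσ
  have hD (i : Fin k) : f (U.split (.inl i)) = V.split (.inl i.rev) := by
    have := Finset.orderEmbOfFin_unique (f := fun i => f (U.split (.inl i.rev))) V.2
      (fun x => Finset.mem_image_of_mem f (hU _)) (fun x y hxy => by
        have h1 := hU x.rev
        simp only [leftToRightMin, Finset.mem_filter_univ] at h1
        exact h1 _ (U.split_inl_lt.2 (Fin.rev_lt_rev.2 hxy)))
    simpa [Choice.split] using congrFun this i.rev
  refine ⟨U, V, σ, ⟨?_, ?_⟩, ?_⟩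
  · intro i j hij
    have := congrArg (fun l => V.split (.inr l)) hij
    simpa [hσ, hf.eq_iff] using this
  · rintro ⟨b, c, d, e, h1, h2, h3, h4, h5, h6⟩
    have hb := hU' b
    simp only [leftToRightMin, Finset.mem_filter_univ, not_forall, not_lt] at hb
    obtain ⟨a, ha, ha'⟩ := hb
    refine h ⟨a, U.split (.inr b), U.split (.inr c), U.split (.inr d), U.split (.inr e), ha,
      lt_of_le_of_ne ha' (hf.ne ha.ne), ?_⟩
    simpa only [Is1324, ← hσ, Choice.split_inr_lt] using ⟨h1, h2, h3, h4, h5, h6⟩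
  · funext x
    obtain ⟨y | y, rfl⟩ := U.split.surjective x
    · simp [merge, hD]
    · simp [merge, hσ]

theorem card_leftToRightMin_le (M k : ℕ) :
    Nat.card {f : Fin (M + k) → Fin (M + k) //
      (f.Injective ∧ ¬ Has12435 f) ∧ (leftToRightMin f).card = k} ≤
      (M + k).choose k ^ 2 * avoidCount patt1324 M := by
  have : (M + k).choose k ^ 2 * avoidCount patt1324 M = Nat.card ((Choice M k × Choice M k) ×
      {σ : Fin M → Fin M // σ.Injective ∧ ¬ Has1324 σ}) := by
    rw [Nat.card_prod, Nat.card_prod, card_choice, avoidCount_patt1324, sq]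
  rw [this]
  choose U V σ hσ h using fun f : {f : Fin (M + k) → Fin (M + k) //
    (f.Injective ∧ ¬ Has12435 f) ∧ (leftToRightMin f).card = k} =>
      exists_merge_eq f.2.1.1 f.2.1.2 f.2.2
  refine Nat.card_le_card_of_injective (fun f => ((U f, V f), ⟨σ f, hσ f⟩)) ?_
  intro f g hfg
  simp only [Prod.mk.injEq, Subtype.mk.injEq] at hfg
  obtain ⟨⟨h1, h2⟩, h3⟩ := hfg
  exact Subtype.ext (by rw [← h f, ← h g, h1, h2, h3])

theorem avoidCount_patt53421_le (n : ℕ) : avoidCount patt53421 n ≤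
    ∑ k ∈ Finset.range (n + 1), n.choose k ^ 2 * avoidCount patt1324 (n - k) := by
  classical
  rw [avoidCount_patt53421, Nat.card_eq_fintype_card, Fintype.card_subtype,
    Finset.card_eq_sum_card_fiberwise (f := fun f => (leftToRightMin f).card)
      (t := Finset.range (n + 1))]
  · refine Finset.sum_le_sum fun k hk => ?_
    obtain ⟨M, rfl⟩ := Nat.exists_eq_add_of_le' (Finset.mem_range_succ_iff.1 hk)
    rw [Nat.add_sub_cancel]
    refine le_of_eq_of_le ?_ (card_leftToRightMin_le M k)
    rw [Nat.card_eq_fintype_card, Fintype.card_subtype, Finset.filter_filter]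
  · intro f _
    simpa [Nat.lt_succ_iff] using Finset.card_le_univ (leftToRightMin f)

theorem avoidCount_patt1324_pos (n : ℕ) : 0 < avoidCount patt1324 n := by
  rw [avoidCount_patt1324]
  have : Nonempty {σ : Fin n → Fin n // σ.Injective ∧ ¬ Has1324 σ} := by
    refine ⟨⟨Fin.rev, Fin.rev_injective, ?_⟩⟩
    rintro ⟨b, c, d, e, h1, h2, h3, h4, h5, h6⟩
    exact (Fin.rev_lt_rev.1 h6).asymm (h2.trans h3)
  exact Nat.card_pos

end Counting

section Growth

variable {a b : ℕ → ℕ} {L l c : ℝ}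

theorem lt_root_iff (hc : 0 ≤ c) {x : ℝ} (hx : 0 ≤ x) {n : ℕ} (hn : n ≠ 0) :
    c < x ^ (1 / (n : ℝ)) ↔ c ^ n < x := by
  rw [one_div, Real.lt_rpow_inv_iff_of_pos hc hx (by positivity), Real.rpow_natCast]

theorem root_lt_iff (hc : 0 ≤ c) {x : ℝ} (hx : 0 ≤ x) {n : ℕ} (hn : n ≠ 0) :
    x ^ (1 / (n : ℝ)) < c ↔ x < c ^ n := by
  rw [one_div, Real.rpow_inv_lt_iff_of_pos hx hc (by positivity), Real.rpow_natCast]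

theorem exists_mul_pow_le (ha : ∀ n, 0 < a n) (hl : 0 ≤ l) (hlL : l < L)
    (hL : Tendsto (fun n : ℕ => (a n : ℝ) ^ (1 / (n : ℝ))) atTop (nhds L)) :
    ∃ C > 0, ∀ n, l ^ n ≤ C * a n := by
  have : (fun n => l ^ n) =O[atTop] fun n => (a n : ℝ) := by
    refine Asymptotics.IsBigO.of_bound 1 ?_
    filter_upwards [hL.eventually_const_lt hlL, eventually_ne_atTop 0] with n hn hn0
    rw [lt_root_iff hl (by positivity) hn0] at hn
    simpa [abs_of_nonneg hl] using hn.le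
  obtain ⟨C, hC, h⟩ := Asymptotics.bound_of_isBigO_nat_atTop this
  refine ⟨C, hC, fun n => ?_⟩
  simpa [abs_of_nonneg hl] using h (x := n) (by exact_mod_cast (ha n).ne')

theorem exists_le_mul_pow (hl : 0 < l) (hlL : L < l)
    (hL : Tendsto (fun n : ℕ => (a n : ℝ) ^ (1 / (n : ℝ))) atTop (nhds L)) :
    ∃ C > 0, ∀ n, a n ≤ C * l ^ n := by
  have : (fun n => (a n : ℝ)) =O[atTop] fun n => l ^ n := by
    refine Asymptotics.IsBigO.of_bound 1 ?_
    filter_upwards [hL.eventually_lt_const hlL, eventually_ne_atTop 0] with n hn hn0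
    rw [root_lt_iff hl.le (by positivity) hn0] at hn
    simpa [abs_of_pos hl] using hn.le
  obtain ⟨C, hC, h⟩ := Asymptotics.bound_of_isBigO_nat_atTop this
  refine ⟨C, hC, fun n => ?_⟩
  simpa [abs_of_pos hl] using h (x := n) (by positivity)

theorem one_add_sqrt_pow (l : ℝ) (n : ℕ) : (1 + √l) ^ n =
    ∑ k ∈ Finset.range (n + 1), √l ^ (n - k) * n.choose k := by
  simp [add_pow]

theorem term_sq (hl : 0 ≤ l) (m x : ℕ) : (√l ^ m * x) ^ 2 = x ^ 2 * l ^ m := by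
  rw [mul_pow, ← pow_mul, mul_comm m, pow_mul, Real.sq_sqrt hl, mul_comm]

theorem eventually_root_lt (hL0 : 0 ≤ L)
    (hL : Tendsto (fun n : ℕ => (a n : ℝ) ^ (1 / (n : ℝ))) atTop (nhds L))
    (hb : ∀ n, b n ≤ ∑ k ∈ Finset.range (n + 1), n.choose k ^ 2 * a (n - k))
    (hc : (1 + √L) ^ 2 < c) : ∀ᶠ n : ℕ in atTop, (b n : ℝ) ^ (1 / (n : ℝ)) < c := by
  have hcont : Tendsto (fun l => (1 + √l) ^ 2) (nhdsWithin L (Set.Ioi L)) (nhds ((1 + √L) ^ 2)) :=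
    (Continuous.tendsto (by fun_prop) L).mono_left nhdsWithin_le_nhds
  obtain ⟨l, hlc, hlL : L < l⟩ :=
    ((hcont.eventually_lt_const hc).and self_mem_nhdsWithin).exists
  have hl : 0 < l := hL0.trans_lt hlL
  obtain ⟨C, hC, haC⟩ := exists_le_mul_pow hl hlL hL
  have hbC (n : ℕ) : (b n : ℝ) ≤ C * ((1 + √l) ^ 2) ^ n := by
    calc (b n : ℝ) ≤ ∑ k ∈ Finset.range (n + 1), (n.choose k : ℝ) ^ 2 * a (n - k) := by
          exact_mod_cast hb n
      _ ≤ ∑ k ∈ Finset.range (n + 1), C * (√l ^ (n - k) * n.choose k) ^ 2 := by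
          refine Finset.sum_le_sum fun k _ => ?_
          rw [term_sq hl.le, mul_left_comm]
          gcongr
          exact haC _
      _ ≤ C * (∑ k ∈ Finset.range (n + 1), √l ^ (n - k) * n.choose k) ^ 2 := by
          rw [← Finset.mul_sum]
          gcongr
          exact Finset.sum_sq_le_sq_sum_of_nonneg fun k _ => by positivity
      _ = _ := by rw [← one_add_sqrt_pow, ← pow_mul, ← pow_mul, mul_comm n]
  have hc0 : 0 < c := lt_of_le_of_lt (by positivity) hc
  have hlim := (tendsto_pow_atTop_nhds_zero_of_lt_one (r := (1 + √l) ^ 2 / c) (by positivity)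
    ((div_lt_one hc0).2 hlc)).const_mul C
  rw [mul_zero] at hlim
  filter_upwards [hlim.eventually_lt_const one_pos, eventually_ne_atTop 0] with n hn hn0
  rw [root_lt_iff hc0.le (by positivity) hn0]
  refine (hbC n).trans_lt ?_
  rwa [div_pow, ← mul_div_assoc, div_lt_one (by positivity)] at hn

theorem exists_pow_lt_mul_choose_sq (ha : ∀ n, 0 < a n) (hL0 : 0 < L)
    (hL : Tendsto (fun n : ℕ => (a n : ℝ) ^ (1 / (n : ℝ))) atTop (nhds L))
    (hc0 : 0 ≤ c) (hc : c < (1 + √L) ^ 2) :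
    ∃ M k : ℕ, M + k ≠ 0 ∧ c ^ (M + k) < a M * ((M + k).choose k : ℝ) ^ 2 := by
  by_contra! hcon
  have hcont : Tendsto (fun l => (1 + √l) ^ 2) (nhdsWithin L (Set.Iio L)) (nhds ((1 + √L) ^ 2)) :=
    (Continuous.tendsto (by fun_prop) L).mono_left nhdsWithin_le_nhds
  obtain ⟨l, hlc, hlL : l < L, hl⟩ := ((hcont.eventually_const_lt hc).and
    (eventually_mem_nhdsWithin.and (nhdsWithin_le_nhds (lt_mem_nhds hL0)))).exists
  obtain ⟨C, hC, haC⟩ := exists_mul_pow_le ha hl.le hlL hL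
  have hbound (n : ℕ) (hn : n ≠ 0) : ((1 + √l) ^ 2) ^ n ≤ 4 * C * (n ^ 2 * c ^ n) := by
    calc ((1 + √l) ^ 2) ^ n = (∑ k ∈ Finset.range (n + 1), √l ^ (n - k) * n.choose k) ^ 2 := by
          rw [← one_add_sqrt_pow, ← pow_mul, ← pow_mul, mul_comm n]
      _ ≤ (n + 1 : ℕ) * ∑ k ∈ Finset.range (n + 1), (√l ^ (n - k) * n.choose k) ^ 2 := by
          simpa using sq_sum_le_card_mul_sum_sq (s := Finset.range (n + 1))
            (f := fun k => √l ^ (n - k) * n.choose k)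
      _ ≤ (n + 1 : ℕ) * ∑ k ∈ Finset.range (n + 1), C * c ^ n := by
          gcongr with k hk
          obtain ⟨M, rfl⟩ := Nat.exists_eq_add_of_le' (Finset.mem_range_succ_iff.1 hk)
          rw [Nat.add_sub_cancel, term_sq hl.le]
          calc _ ≤ ((M + k).choose k : ℝ) ^ 2 * (C * a M) := by
                gcongr
                exact haC M
            _ = C * (a M * ((M + k).choose k : ℝ) ^ 2) := by ring
            _ ≤ _ := by
                gcongr
                exact hcon M k hn
      _ = C * c ^ n * (n + 1) ^ 2 := by
          simp only [Finset.sum_const, Finset.card_range, nsmul_eq_mul]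
          push_cast
          ring
      _ ≤ C * c ^ n * (n + n) ^ 2 := by
          gcongr
          exact_mod_cast Nat.one_le_iff_ne_zero.2 hn
      _ = _ := by ring
  have hpos : 0 < (1 + √l) ^ 2 := by positivity
  have hlim := (tendsto_pow_const_mul_const_pow_of_abs_lt_one 2 (r := c / (1 + √l) ^ 2) (by
    rw [abs_of_nonneg (by positivity)]
    exact (div_lt_one hpos).2 hlc)).const_mul (4 * C)
  rw [mul_zero] at hlim
  obtain ⟨n, hn, hn0⟩ := ((hlim.eventually_lt_const one_pos).and (eventually_ne_atTop 0)).exists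
  rw [div_pow, ← mul_div_assoc, ← mul_div_assoc, div_lt_one (by positivity)] at hn
  exact (hbound n hn0).not_gt hn

theorem eventually_lt_root (ha : ∀ n, 0 < a n) (hL0 : 0 < L)
    (hL : Tendsto (fun n : ℕ => (a n : ℝ) ^ (1 / (n : ℝ))) atTop (nhds L))
    (hb : ∀ r M k m, (a M * (M + k).choose k ^ 2) ^ m ≤ b (r + M + m * (M + k)))
    (hc0 : 0 < c) (hc : c < (1 + √L) ^ 2) :
    ∀ᶠ n : ℕ in atTop, c < (b n : ℝ) ^ (1 / (n : ℝ)) := by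
  obtain ⟨M, k, hN, hA⟩ := exists_pow_lt_mul_choose_sq ha hL0 hL hc0.le hc
  set A : ℝ := a M * ((M + k).choose k : ℝ) ^ 2
  have hm : Tendsto (fun n : ℕ => (n - M) / (M + k)) atTop atTop :=
    (Nat.tendsto_div_const_atTop hN).comp (tendsto_sub_atTop_nat M)
  have hlim := (tendsto_pow_atTop_atTop_of_one_lt
    ((one_lt_div (pow_pos hc0 _)).2 hA)).comp hm
  filter_upwards [hlim.eventually_gt_atTop (max c 1 ^ (M + k + M)), eventually_ne_atTop 0,
    eventually_ge_atTop M] with n hn hn0 hnM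
  rw [lt_root_iff hc0.le (by positivity) hn0]
  have hn' : n = (n - M) % (M + k) + M + (n - M) / (M + k) * (M + k) := by
    have := Nat.mod_add_div' (n - M) (M + k)
    omega
  have hr := Nat.mod_lt (n - M) (Nat.pos_of_ne_zero hN)
  have hbn := hb ((n - M) % (M + k)) M k ((n - M) / (M + k))
  rw [← hn'] at hbn
  simp only [Function.comp_apply, div_pow] at hn
  rw [lt_div_iff₀ (by positivity)] at hn
  calc c ^ n = c ^ ((n - M) % (M + k) + M) * (c ^ (M + k)) ^ ((n - M) / (M + k)) := by
        conv_lhs => rw [hn']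
        rw [pow_add, mul_comm _ (M + k), pow_mul]
    _ ≤ max c 1 ^ (M + k + M) * (c ^ (M + k)) ^ ((n - M) / (M + k)) := by
        gcongr
        calc c ^ ((n - M) % (M + k) + M) ≤ max c 1 ^ ((n - M) % (M + k) + M) := by
              gcongr
              exact le_max_left _ _
          _ ≤ _ := pow_le_pow_right₀ (le_max_right _ _) (by omega)
    _ < A ^ ((n - M) / (M + k)) := hn
    _ ≤ b n := by
        simp only [A]
        exact_mod_cast hbn

end Growth

/-- Bóna: if `L` is the Stanley–Wilf growth constant of the pattern `1324`,
then the Stanley–Wilf growth constant of the pattern `53421` is `(1 + √L)²`. -/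
theorem stmt_13 (L : ℝ)
    (hL : Tendsto (fun n : ℕ => (avoidCount patt1324 n : ℝ) ^ (1 / (n : ℝ)))
      atTop (nhds L)) :
    Tendsto (fun n : ℕ => (avoidCount patt53421 n : ℝ) ^ (1 / (n : ℝ)))
      atTop (nhds ((1 + Real.sqrt L) ^ 2)) := by
  have hL1 : 1 ≤ L := ge_of_tendsto' hL fun n =>
    Real.one_le_rpow (by exact_mod_cast avoidCount_patt1324_pos n) (by positivity)
  have hL0 : 0 < L := one_pos.trans_le hL1
  rw [tendsto_order]
  constructor
  · intro c hc
    obtain ⟨c', hc', hc''⟩ := exists_between (max_lt hc (show 0 < (1 + √L) ^ 2 by positivity))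
    filter_upwards [eventually_lt_root avoidCount_patt1324_pos hL0 hL pow_le_avoidCount_patt53421
      ((le_max_right _ _).trans_lt hc') hc''] with n hn
    exact ((le_max_left _ _).trans_lt hc').trans hn
  · intro c hc
    exact eventually_root_lt hL0.le hL avoidCount_patt53421_le hc
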